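/- arXiv:2310.18125 — 2 statements merged into one kernel-verified Lean document; each statement's English description precedes it below -/
import Mathlib

section
/- Let Γ be a countable discrete group, let A and B be separable unital C*-algebras with actions α: Γ → Aut(A) and β: Γ → Aut(B), and let (φ, v): (A, α) → (B, β) be a cocycle morphism with φ injective. Then (φ, v) is asymptotically unitarily equivalent to a cocycle conjugacy if and only if: for every ε > 0, every finite set K ⊆ Γ containing 1, and all finite sets F ⊆ A and G ⊆ B, there exists a norm-continuous path z: [0,1] → U(B) with z_0 = 1 such that sup_{0 ≤ t ≤ 1} ‖β_g(z_t) v_g φ(a) z_t* − v_g φ(a)‖ ≤ ε for all g ∈ K and a ∈ F, and dist(β_g(z_1)* b z_1, {v_g φ(a) : a ∈ A}) ≤ ε for all g ∈ K and b ∈ G. -/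
open Filter Topology

/-- `α : Γ → Aut(A)` is an action of the group `Γ` on the unital C⋆-algebra `A` by
⋆-automorphisms. -/
def IsCStarAction {Γ A : Type*} [Group Γ] [CStarAlgebra A] (α : Γ → A ≃⋆ₐ[ℂ] A) : Prop :=
  (∀ a : A, α 1 a = a) ∧ ∀ g h : Γ, ∀ a : A, α (g * h) a = α g (α h a)

/-- The cocycle conditions for a pair `(φ, v)`. -/
def IsCocyclePair {Γ A B : Type*} [Group Γ] [CStarAlgebra A] [CStarAlgebra B]
    (α : Γ → A ≃⋆ₐ[ℂ] A) (β : Γ → B ≃⋆ₐ[ℂ] B) (φ : A → B) (v : Γ → unitary B) : Prop :=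
  v 1 = 1 ∧
  (∀ (g : Γ) (a : A), β g (φ a) * (v g : B) = (v g : B) * φ (α g a)) ∧
  (∀ g h : Γ, (v (g * h) : B) = β g (v h) * (v g : B))

/-- Asymptotic unitary equivalence of (formal) cocycle morphisms `(φ, v)` and `(ψ, w)`. -/
def CocycleAsympUnitaryEquiv {Γ A B : Type*} [Group Γ] [CStarAlgebra A] [CStarAlgebra B]
    (β : Γ → B ≃⋆ₐ[ℂ] B) (φ ψ : A → B) (v w : Γ → B) : Prop :=
  ∃ u : ℝ → unitary B,
    ContinuousOn (fun t => (u t : B)) (Set.Ici (0 : ℝ)) ∧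
    ∀ (g : Γ) (a : A),
      Tendsto (fun t => ‖β g (u t) * v g * φ a * star ((u t : B)) - w g * ψ a‖) atTop (𝓝 (0 : ℝ))

/-- The perturbation `β_g(u) v_g φ(a) u⋆` of `v_g φ(a)` by the unitary `u`. -/
def cocycleTwist {Γ A B : Type*} [Group Γ] [CStarAlgebra A] [CStarAlgebra B]
    (β : Γ → B ≃⋆ₐ[ℂ] B) (φ : A → B) (v : Γ → unitary B) (u : unitary B) (g : Γ) (a : A) : B :=
  β g (u : B) * (v g : B) * φ a * star (u : B)

theorem norm_starAlgEquiv_apply {B : Type*} [CStarAlgebra B] (e : B ≃⋆ₐ[ℂ] B) (b : B) :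
    ‖e b‖ = ‖b‖ :=
  NonUnitalStarAlgHom.norm_map e e.injective b

theorem norm_unitary_conj {B : Type*} [CStarAlgebra B] (e : B ≃⋆ₐ[ℂ] B) (u : unitary B) (b : B) :
    ‖e (u : B) * b * star (u : B)‖ = ‖b‖ := by
  have h : e (u : B) ∈ unitary B := Unitary.map_mem e u.2
  rw [← Unitary.coe_star, CStarRing.norm_mul_coe_unitary]
  exact CStarRing.norm_coe_unitary_mul ⟨_, h⟩ b

theorem norm_star_unitary_conj {B : Type*} [CStarAlgebra B] (e : B ≃⋆ₐ[ℂ] B) (u : unitary B)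
    (b : B) : ‖star (e (u : B)) * b * (u : B)‖ = ‖b‖ := by
  simpa [map_star] using norm_unitary_conj e (star u) b

theorem star_map_unitary_mul_self {B : Type*} [CStarAlgebra B] (e : B ≃⋆ₐ[ℂ] B) (u : unitary B) :
    star (e (u : B)) * e (u : B) = 1 :=
  (Unitary.map_mem e u.2).1

theorem map_unitary_mul_star_self {B : Type*} [CStarAlgebra B] (e : B ≃⋆ₐ[ℂ] B) (u : unitary B) :
    e (u : B) * star (e (u : B)) = 1 :=
  (Unitary.map_mem e u.2).2

section

variable {Γ A B : Type*} [Group Γ] [CStarAlgebra A] [CStarAlgebra B]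
  {β : Γ → B ≃⋆ₐ[ℂ] B} {φ : A →⋆ₙₐ[ℂ] B} {v : Γ → unitary B}

theorem cocycleTwist_one (g : Γ) (a : A) : cocycleTwist β φ v 1 g a = v g * φ a := by
  simp [cocycleTwist]

theorem cocycleTwist_mul (x z : unitary B) (g : Γ) (a : A) :
    cocycleTwist β φ v (x * z) g a = β g (x : B) * cocycleTwist β φ v z g a * star (x : B) := by
  simp [cocycleTwist, mul_assoc]

theorem norm_cocycleTwist_mul_sub (x z : unitary B) (g : Γ) (a : A) :
    ‖cocycleTwist β φ v (x * z) g a - cocycleTwist β φ v x g a‖ =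
      ‖cocycleTwist β φ v z g a - v g * φ a‖ := by
  have h := cocycleTwist_mul (β := β) (φ := φ) (v := v) x 1 g a
  rw [mul_one, cocycleTwist_one] at h
  rw [h, cocycleTwist_mul, ← sub_mul, ← mul_sub, norm_unitary_conj]

theorem norm_cocycleTwist (u : unitary B) (g : Γ) (a : A) :
    ‖cocycleTwist β φ v u g a‖ = ‖φ a‖ := by
  rw [cocycleTwist, mul_assoc (β g (u : B)), norm_unitary_conj, CStarRing.norm_coe_unitary_mul]

theorem cocycleTwist_sub (u : unitary B) (g : Γ) (a b : A) :
    cocycleTwist β φ v u g (a - b) = cocycleTwist β φ v u g a - cocycleTwist β φ v u g b := by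
  simp [cocycleTwist, mul_sub, sub_mul]

/-- A path of unitaries implementing an asymptotic unitary equivalence with a cocycle conjugacy,
restricted to late times and normalised to start at `1`, satisfies the intertwining criterion. -/
theorem exists_path_of_cocycleAsympUnitaryEquiv {Φ : A ≃⋆ₐ[ℂ] B} {V : Γ → unitary B}
    (h : CocycleAsympUnitaryEquiv β φ Φ (fun g => (v g : B)) (fun g => (V g : B)))
    {ε : ℝ} (hε : 0 < ε) (K : Finset Γ) (F : Finset A) (G : Finset B) :
    ∃ z : ℝ → unitary B,
      ContinuousOn (fun t => (z t : B)) (Set.Icc (0 : ℝ) 1) ∧ z 0 = 1 ∧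
      (∀ t ∈ Set.Icc (0 : ℝ) 1, ∀ g ∈ K, ∀ a ∈ F,
        ‖cocycleTwist β φ v (z t) g a - v g * φ a‖ ≤ ε) ∧
      (∀ g ∈ K, ∀ b ∈ G, Metric.infDist (star (β g (z 1 : B)) * b * (z 1 : B))
        (Set.range fun a : A => (v g : B) * φ a) ≤ ε) := by
  obtain ⟨u, hu, hlim⟩ := h
  have hev : ∀ (g : Γ) (a : A), ∀ᶠ t in atTop,
      ∀ r ≥ t, ‖cocycleTwist β φ v (u r) g a - V g * Φ a‖ < ε / 2 := fun g a =>
    eventually_forall_ge_atTop.2 ((hlim g a).eventually (gt_mem_nhds (half_pos hε)))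
  obtain ⟨s, hs, hs0⟩ := (((K.eventually_all).2 fun g _ => (F.eventually_all).2 fun a _ =>
    hev g a).and (eventually_ge_atTop (0 : ℝ))).exists
  have hsurj : ∀ (g : Γ) (b : B), ∃ a : A,
      (V g : B) * Φ a = β g (u s : B) * b * star (u s : B) := fun g b => by
    obtain ⟨a, ha⟩ := Φ.surjective (star (V g : B) * (β g (u s : B) * b * star (u s : B)))
    change Φ a = _ at ha
    refine ⟨a, ?_⟩
    rw [ha, ← mul_assoc, Unitary.mul_star_self_of_mem (V g).2, one_mul]
  choose c hc using hsurj
  obtain ⟨S, hS, hsS⟩ := (((K.eventually_all).2 fun g _ => (G.eventually_all).2 fun b _ =>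
    hev g (c g b)).and (eventually_ge_atTop s)).exists
  refine ⟨fun t => star (u s) * u (s + t * (S - s)), ?_, by simp, ?_, ?_⟩
  · simp only [Submonoid.coe_mul]
    refine continuousOn_const.mul (hu.comp (by fun_prop) fun t ht => ?_)
    have := mul_nonneg ht.1 (sub_nonneg.2 hsS)
    exact Set.mem_Ici.2 (by linarith)
  · intro t ht g hg a ha
    have hr : s ≤ s + t * (S - s) := by
      have := mul_nonneg ht.1 (sub_nonneg.2 hsS)
      linarith
    rw [← norm_cocycleTwist_mul_sub (u s), ← mul_assoc, Unitary.mul_star_self, one_mul]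
    have h1 := hs g hg a ha _ hr
    have h2 := hs g hg a ha s le_rfl
    rw [norm_sub_rev] at h2
    refine (norm_sub_le_norm_sub_add_norm_sub _ ((V g : B) * Φ a) _).trans ?_
    linarith
  · intro g hg b hb
    refine (Metric.infDist_le_dist_of_mem (Set.mem_range_self (c g b))).trans ?_
    have h1 := hS g hg b hb S le_rfl
    rw [hc, norm_sub_rev, ← norm_star_unitary_conj (β g) (u S)] at h1
    rw [dist_eq_norm]
    refine le_trans (le_of_eq ?_) (h1.le.trans (half_le_self hε.le))
    congr 1
    rw [mul_sub, sub_mul, cocycleTwist]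
    congr 1
    · simp [mul_assoc, map_star]
    · have e1 := star_map_unitary_mul_self (β g) (u S)
      have e2 : star (u S : B) * (u S : B) = 1 := (u S).2.1
      calc (v g : B) * φ (c g b)
          = (star (β g (u S : B)) * β g (u S : B)) * (v g * φ (c g b)) *
              (star (u S : B) * (u S : B)) := by rw [e1, e2, one_mul, mul_one]
        _ = _ := by simp only [mul_assoc]

/-- A function on the half-line whose oscillation on `[n, n + 1]` is at most `2⁻ⁿ` stays within
`2 * 2⁻ⁿ` of its value at `n`. -/
theorem norm_sub_le_of_forall_Icc {f : ℝ → B} {N : ℕ}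
    (h : ∀ n ≥ N, ∀ t ∈ Set.Icc (n : ℝ) (n + 1), ‖f t - f n‖ ≤ (1 / 2) ^ n) {n : ℕ} (hn : N ≤ n)
    {t : ℝ} (ht : (n : ℝ) ≤ t) : ‖f t - f n‖ ≤ 2 * (1 / 2) ^ n := by
  have key : ∀ m ≥ n, ‖f (m : ℕ) - f n‖ ≤ 2 * (1 / 2) ^ n - 2 * (1 / 2) ^ m := by
    intro m hm
    induction m, hm using Nat.le_induction with
    | base => simp
    | succ m hm ih =>
      have h1 := h m (hn.trans hm) (m + 1) (by simp)
      have h2 := norm_sub_le_norm_sub_add_norm_sub (f (m + 1)) (f m) (f n)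
      push_cast
      rw [pow_succ]
      linarith
  have h0 : 0 ≤ t := n.cast_nonneg.trans ht
  have hm : n ≤ ⌊t⌋₊ := Nat.le_floor ht
  have h1 := key _ hm
  have h2 := h _ (hn.trans hm) t ⟨Nat.floor_le h0, (Nat.lt_floor_add_one t).le⟩
  have h3 := norm_sub_le_norm_sub_add_norm_sub (f t) (f ⌊t⌋₊) (f n)
  have h4 : (0 : ℝ) < (1 / 2) ^ ⌊t⌋₊ := by positivity
  linarith

theorem continuousOn_Ici_of_forall_Icc {f : ℝ → B}
    (h : ∀ n : ℕ, ContinuousOn f (Set.Icc (n : ℝ) (n + 1))) : ContinuousOn f (Set.Ici 0) := by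
  have key : ∀ n : ℕ, ContinuousOn f (Set.Icc 0 (n : ℝ)) := by
    intro n
    induction n with
    | zero => simp
    | succ n ih =>
      have := ih.union_of_isClosed (h n) isClosed_Icc isClosed_Icc
      rw [Set.Icc_union_Icc_eq_Icc n.cast_nonneg (by linarith)] at this
      exact_mod_cast this
  intro t ht
  obtain ⟨n, hn⟩ := exists_nat_gt t
  refine (key n t ⟨ht, hn.le⟩).mono_of_mem_nhdsWithin ?_
  filter_upwards [self_mem_nhdsWithin, mem_nhdsWithin_of_mem_nhds (Iio_mem_nhds hn)] with r h1 h2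
  exact ⟨h1, (Set.mem_Iio.1 h2).le⟩

/-- The infinite concatenation of paths of unitaries underlying the intertwining argument. -/
theorem exists_ray_of_forall_exists_path
    (H : ∀ ε : ℝ, 0 < ε → ∀ K : Finset Γ, (1 : Γ) ∈ K → ∀ (F : Finset A) (G : Finset B),
      ∃ z : ℝ → unitary B,
        ContinuousOn (fun t => (z t : B)) (Set.Icc (0 : ℝ) 1) ∧ z 0 = 1 ∧
        (∀ t ∈ Set.Icc (0 : ℝ) 1, ∀ g ∈ K, ∀ a ∈ F,
          ‖cocycleTwist β φ v (z t) g a - v g * φ a‖ ≤ ε) ∧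
        (∀ b ∈ G, Metric.infDist (star (z 1 : B) * b * (z 1 : B)) (Set.range φ) ≤ ε))
    (K : ℕ → Finset Γ) (hK : ∀ n, 1 ∈ K n) (a : ℕ → A) (b : ℕ → B) :
    ∃ (u : ℝ → unitary B) (F : ℕ → Finset A),
      ContinuousOn (fun t => (u t : B)) (Set.Ici 0) ∧ Monotone F ∧ (∀ n, a n ∈ F (n + 1)) ∧
      (∀ n : ℕ, ∀ t ∈ Set.Icc (n : ℝ) (n + 1), ∀ g ∈ K n, ∀ c ∈ F n,
        ‖cocycleTwist β φ v (u t) g c - cocycleTwist β φ v (u n) g c‖ ≤ (1 / 2) ^ n) ∧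
      (∀ n : ℕ, ∀ j ≤ n, ∃ c ∈ F (n + 1),
        ‖star (u (n + 1 : ℕ) : B) * b j * (u (n + 1 : ℕ) : B) - φ c‖ ≤ 2 * (1 / 2) ^ n) := by
  classical
  have step : ∀ (n : ℕ) (s : unitary B × Finset A), ∃ (z : ℝ → unitary B) (F' : Finset A),
      ContinuousOn (fun t => (z t : B)) (Set.Icc (0 : ℝ) 1) ∧ z 0 = 1 ∧
      (∀ t ∈ Set.Icc (0 : ℝ) 1, ∀ g ∈ K n, ∀ c ∈ s.2,
        ‖cocycleTwist β φ v (z t) g c - v g * φ c‖ ≤ (1 / 2) ^ n) ∧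
      s.2 ⊆ F' ∧ a n ∈ F' ∧
      ∀ j ≤ n, ∃ c ∈ F',
        ‖star ((s.1 * z 1 : unitary B) : B) * b j * ((s.1 * z 1 : unitary B) : B) - φ c‖
          ≤ 2 * (1 / 2) ^ n := by
    rintro n ⟨x, F⟩
    have hε : (0 : ℝ) < (1 / 2) ^ n := by positivity
    obtain ⟨z, hz, hz0, hzF, hzG⟩ := H _ hε (K n) (hK n) F
      ((Finset.range (n + 1)).image fun j => star (x : B) * b j * (x : B))
    have hc : ∀ j : ℕ, ∃ c : A, j ≤ n →
        ‖star ((x * z 1 : unitary B) : B) * b j * ((x * z 1 : unitary B) : B) - φ c‖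
          ≤ 2 * (1 / 2) ^ n := by
      intro j
      by_cases hj : j ≤ n
      · have h1 := hzG _ (Finset.mem_image_of_mem _ (Finset.mem_range.2 (Nat.lt_succ_of_le hj)))
        have h2 : Metric.infDist (star (z 1 : B) * (star (x : B) * b j * (x : B)) * (z 1 : B))
            (Set.range φ) < 2 * (1 / 2) ^ n := by linarith
        obtain ⟨_, ⟨c, rfl⟩, hc⟩ := (Metric.infDist_lt_iff (Set.range_nonempty φ)).1 h2
        refine ⟨c, fun _ => ?_⟩
        rw [dist_eq_norm] at hc
        simpa [mul_assoc] using hc.le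
      · exact ⟨0, fun h => absurd h hj⟩
    choose c hc using hc
    refine ⟨z, F ∪ insert (a n) ((Finset.range (n + 1)).image c), hz, hz0, hzF,
      Finset.subset_union_left, by simp, fun j hj => ⟨c j, ?_, hc j hj⟩⟩
    exact Finset.mem_union_right _ (Finset.mem_insert_of_mem
      (Finset.mem_image_of_mem _ (Finset.mem_range.2 (Nat.lt_succ_of_le hj))))
  choose z F' hz hz0 hzK hsub haF hb using step
  let s : ℕ → unitary B × Finset A := fun n =>
    Nat.rec (1, ∅) (fun n s => (s.1 * z n s 1, F' n s)) n
  have hs : ∀ n, s (n + 1) = ((s n).1 * z n (s n) 1, F' n (s n)) := fun n => rfl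
  let u : ℝ → unitary B := fun t => (s ⌊t⌋₊).1 * z ⌊t⌋₊ (s ⌊t⌋₊) (t - ⌊t⌋₊)
  have hun : ∀ n : ℕ, u n = (s n).1 := fun n => by simp [u, hz0]
  have hu : ∀ n : ℕ, ∀ t ∈ Set.Icc (n : ℝ) (n + 1), u t = (s n).1 * z n (s n) (t - n) := by
    intro n t ht
    rcases ht.2.eq_or_lt with rfl | hlt
    · have := hun (n + 1)
      push_cast at this
      rw [this, hs]
      simp
    · have : ⌊t⌋₊ = n := (Nat.floor_eq_iff (n.cast_nonneg.trans ht.1)).2 ⟨ht.1, hlt⟩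
      simp only [u, this]
  refine ⟨u, fun n => (s n).2, continuousOn_Ici_of_forall_Icc fun n => ?_,
    monotone_nat_of_le_succ fun n => hsub n (s n), fun n => haF n (s n), ?_, ?_⟩
  · have : ContinuousOn (fun t => ((s n).1 : B) * (z n (s n) (t - n) : B))
        (Set.Icc (n : ℝ) (n + 1)) := by
      refine continuousOn_const.mul ((hz n (s n)).comp (by fun_prop) fun t ht => ?_)
      exact ⟨by linarith [ht.1], by linarith [ht.2]⟩
    refine this.congr fun t ht => ?_
    simp [hu n t ht]
  · intro n t ht g hg c hc
    rw [hu n t ht, hun, norm_cocycleTwist_mul_sub]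
    exact hzK n (s n) _ ⟨by linarith [ht.1], by linarith [ht.2]⟩ g hg c hc
  · intro n j hj
    obtain ⟨c, hc, h⟩ := hb n (s n) j hj
    refine ⟨c, hc, ?_⟩
    rwa [hun, hs]

/-- A pointwise limit of perturbations of a cocycle morphism is a cocycle morphism, and the limit
is isometric. -/
theorem exists_limit_cocyclePair {α : Γ → A ≃⋆ₐ[ℂ] A} (hβ : IsCStarAction β) (hφv : IsCocyclePair α β φ v)
    (hinj : Function.Injective φ) (h1 : φ 1 = 1) {u : ℝ → unitary B} {W : Γ → A → B}
    (hW : ∀ g a, Tendsto (fun t => cocycleTwist β φ v (u t) g a) atTop (𝓝 (W g a))) :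
    ∃ (Φ : A →⋆ₙₐ[ℂ] B) (V : Γ → unitary B), IsCocyclePair α β Φ V ∧ (∀ a, ‖Φ a‖ = ‖a‖) ∧
      ∀ g a, W g a = V g * Φ a := by
  obtain ⟨hv1, hv2, hv3⟩ := hφv
  have hβ1 : ∀ b, β 1 b = b := hβ.1
  have hT1 : ∀ t a, cocycleTwist β φ v (u t) 1 a = (u t : B) * φ a * star (u t : B) := by
    simp [cocycleTwist, hβ1, hv1]
  have huu : ∀ t, star (u t : B) * (u t : B) = 1 := fun t => (u t).2.1
  have hassoc : ∀ (t : ℝ) (x : B), star (u t : B) * ((u t : B) * x) = x := fun t x => by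
    rw [← mul_assoc, huu, one_mul]
  have hW1 : ∀ a, Tendsto (fun t => (u t : B) * φ a * star (u t : B)) atTop (𝓝 (W 1 a)) :=
    fun a => by simpa only [hT1] using hW 1 a
  have hWu : ∀ g, Tendsto (fun t => β g (u t : B) * v g * star (u t : B)) atTop (𝓝 (W g 1)) :=
    fun g => by simpa only [cocycleTwist, h1, mul_one] using hW g 1
  have hVmem : ∀ g, W g 1 ∈ unitary B := fun g => by
    refine isClosed_unitary.mem_of_tendsto (hWu g) (Eventually.of_forall fun t => ?_)
    exact mul_mem (mul_mem (Unitary.map_mem (β g) (u t).2) (v g).2) (Unitary.star_mem (u t).2)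
  have hcont : ∀ g, Continuous (β g) := fun g =>
    (NonUnitalStarAlgHom.isometry (β g) (β g).injective).continuous
  let Φ : A →⋆ₙₐ[ℂ] B :=
    { toFun := W 1
      map_smul' := fun c a => tendsto_nhds_unique (hW1 (c • a)) (by
        simpa only [map_smul, mul_smul_comm, smul_mul_assoc] using! (hW1 a).const_smul c)
      map_zero' := tendsto_nhds_unique (hW1 0) (by simp)
      map_add' := fun a b => tendsto_nhds_unique (hW1 (a + b)) (by
        simpa only [map_add, mul_add, add_mul] using (hW1 a).add (hW1 b))
      map_mul' := fun a b => tendsto_nhds_unique (hW1 (a * b)) (by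
        simpa only [map_mul, mul_assoc, hassoc] using (hW1 a).mul (hW1 b))
      map_star' := fun a => tendsto_nhds_unique (hW1 (star a)) (by
        simpa only [map_star, star_mul, star_star, mul_assoc] using (hW1 a).star) }
  have hΦ : ∀ a, Φ a = W 1 a := fun a => rfl
  refine ⟨Φ, fun g => ⟨W g 1, hVmem g⟩, ⟨?_, ?_, ?_⟩, ?_, ?_⟩
  · ext
    refine tendsto_nhds_unique (hWu 1) ?_
    simp [hβ1, hv1]
  · intro g a
    refine tendsto_nhds_unique ((((hcont g).tendsto _).comp (hW1 a)).mul (hWu g)) ?_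
    refine ((hWu g).mul (hW1 (α g a))).congr fun t => ?_
    have e := star_map_unitary_mul_self (β g) (u t)
    have e' : ∀ x, star (β g (u t : B)) * (β g (u t : B) * x) = x := fun x => by
      rw [← mul_assoc, e, one_mul]
    have e2 : ∀ x, (v g : B) * (φ (α g a) * x) = β g (φ a) * (v g * x) := fun x => by
      rw [← mul_assoc, ← hv2, mul_assoc]
    simp only [Function.comp_apply, map_mul, map_star, mul_assoc, hassoc, e', e2]
  · intro g h
    refine tendsto_nhds_unique (hWu (g * h)) ?_
    refine ((((hcont g).tendsto _).comp (hWu h)).mul (hWu g)).congr fun t => ?_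
    have e := star_map_unitary_mul_self (β g) (u t)
    have e' : ∀ x, star (β g (u t : B)) * (β g (u t : B) * x) = x := fun x => by
      rw [← mul_assoc, e, one_mul]
    simp only [Function.comp_apply, map_mul, map_star, mul_assoc, e', hv3, hβ.2]
  · intro a
    refine tendsto_nhds_unique (hW1 a).norm ?_
    simp only [← hT1, norm_cocycleTwist, NonUnitalStarAlgHom.norm_map φ hinj]
    exact tendsto_const_nhds
  · intro g a
    refine tendsto_nhds_unique (hW g a) (((hWu g).mul (hW1 a)).congr fun t => ?_)
    simp only [cocycleTwist, mul_assoc, hassoc]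

/-- An injective ⋆-homomorphism whose range comes arbitrarily close to the unit is unital. -/
theorem map_one_of_infDist_one_le (hinj : Function.Injective φ)
    (h : ∀ ε > 0, Metric.infDist (1 : B) (Set.range φ) ≤ ε) : φ 1 = 1 := by
  have hcl : IsClosed (Set.range φ) :=
    (NonUnitalStarAlgHom.isometry φ hinj).isClosedEmbedding.isClosed_range
  have h0 : Metric.infDist (1 : B) (Set.range φ) = 0 :=
    le_antisymm (le_of_forall_pos_le_add fun ε hε => by simpa using h ε hε) Metric.infDist_nonneg
  obtain ⟨a, ha⟩ := (hcl.mem_iff_infDist_zero (Set.range_nonempty φ)).2 h0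
  calc φ 1 = φ 1 * φ a := by rw [ha, mul_one]
    _ = φ a := by rw [← map_mul, one_mul]
    _ = 1 := ha

end

/-- A one-sided intertwining criterion: an injective cocycle morphism `(φ, v)`
is asymptotically unitarily equivalent to a cocycle conjugacy iff for all tolerances `ε`, finite
`K ⊆ Γ` with `1 ∈ K`, and finite `F ⊆ A`, `G ⊆ B`, there is a norm-continuous unitary path
`z : [0,1] → U(B)` with `z 0 = 1`, almost commuting with the maps `a ↦ v g φ(a)` along the
whole path, and with `z 1` almost conjugating `G` into their ranges. -/
theorem stmt7 {Γ A B : Type*} [Group Γ] [Countable Γ]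
    [CStarAlgebra A] [CStarAlgebra B]
    [TopologicalSpace.SeparableSpace A] [TopologicalSpace.SeparableSpace B]
    (α : Γ → A ≃⋆ₐ[ℂ] A) (β : Γ → B ≃⋆ₐ[ℂ] B)
    (hα : IsCStarAction α) (hβ : IsCStarAction β)
    (φ : A →⋆ₙₐ[ℂ] B) (v : Γ → unitary B) (hφv : IsCocyclePair α β (⇑φ) v)
    (hinj : Function.Injective φ) :
    (∃ (Φ : A ≃⋆ₐ[ℂ] B) (V : Γ → unitary B),
        IsCocyclePair α β (⇑Φ) V ∧
        CocycleAsympUnitaryEquiv β (⇑φ) (⇑Φ) (fun g => (v g : B)) (fun g => (V g : B))) ↔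
      (∀ ε : ℝ, 0 < ε → ∀ K : Finset Γ, (1 : Γ) ∈ K → ∀ (F : Finset A) (G : Finset B),
        ∃ z : ℝ → unitary B,
          ContinuousOn (fun t => (z t : B)) (Set.Icc (0 : ℝ) 1) ∧
          z 0 = 1 ∧
          (∀ t ∈ Set.Icc (0 : ℝ) 1, ∀ g ∈ K, ∀ a ∈ F,
            ‖β g (z t : B) * (v g : B) * φ a * star ((z t : B)) - (v g : B) * φ a‖ ≤ ε) ∧
          (∀ g ∈ K, ∀ b ∈ G,
            Metric.infDist (star (β g (z 1 : B)) * b * (z 1 : B))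
              (Set.range fun a : A => (v g : B) * φ a) ≤ ε)) := by
  constructor
  · rintro ⟨Φ, V, -, h⟩ ε hε K - F G
    exact exists_path_of_cocycleAsympUnitaryEquiv h hε K F G
  intro H
  have H' : ∀ ε : ℝ, 0 < ε → ∀ K : Finset Γ, (1 : Γ) ∈ K → ∀ (F : Finset A) (G : Finset B),
      ∃ z : ℝ → unitary B,
        ContinuousOn (fun t => (z t : B)) (Set.Icc (0 : ℝ) 1) ∧ z 0 = 1 ∧
        (∀ t ∈ Set.Icc (0 : ℝ) 1, ∀ g ∈ K, ∀ a ∈ F,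
          ‖cocycleTwist β φ v (z t) g a - v g * φ a‖ ≤ ε) ∧
        (∀ b ∈ G, Metric.infDist (star (z 1 : B) * b * (z 1 : B)) (Set.range φ) ≤ ε) := by
    intro ε hε K hK F G
    obtain ⟨z, hz, hz0, hzF, hzG⟩ := H ε hε K hK F G
    refine ⟨z, hz, hz0, hzF, fun b hb => ?_⟩
    have h := hzG 1 hK b hb
    simp only [hβ.1, hφv.1, OneMemClass.coe_one, one_mul] at h
    exact h
  have h1 : φ 1 = 1 := map_one_of_infDist_one_le hinj fun ε hε => by
    obtain ⟨z, -, -, -, hz⟩ := H' ε hε {1} (by simp) ∅ {1}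
    simpa using hz 1 (by simp)
  classical
  obtain ⟨γ, hγ⟩ := exists_surjective_nat Γ
  let K : ℕ → Finset Γ := fun n => insert 1 ((Finset.range n).image γ)
  have hKmem : ∀ m n, m < n → γ m ∈ K n := fun m n hmn =>
    Finset.mem_insert_of_mem (Finset.mem_image_of_mem _ (Finset.mem_range.2 hmn))
  obtain ⟨u, F, hu, hFmono, haF, huF, hub⟩ := exists_ray_of_forall_exists_path H' K
    (fun n => Finset.mem_insert_self _ _) (TopologicalSpace.denseSeq A)
    (TopologicalSpace.denseSeq B)
  have hpow : ∀ ε : ℝ, 0 < ε → ∃ N : ℕ, ∀ n ≥ N, (2 : ℝ) * (1 / 2) ^ n < ε := fun ε hε => by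
    have : Tendsto (fun n : ℕ => (2 : ℝ) * (1 / 2) ^ n) atTop (𝓝 (2 * 0)) :=
      (tendsto_pow_atTop_nhds_zero_of_lt_one (by norm_num) (by norm_num)).const_mul _
    rw [mul_zero] at this
    exact eventually_atTop.1 (this.eventually (gt_mem_nhds hε))
  have hcauchy : ∀ g a, CauchySeq fun t => cocycleTwist β φ v (u t) g a := by
    intro g a
    rw [Metric.cauchySeq_iff']
    intro ε hε
    obtain ⟨k, rfl⟩ := hγ g
    obtain ⟨m, hm⟩ :=
      (TopologicalSpace.denseRange_denseSeq A).exists_dist_lt a (show 0 < ε / 3 by positivity)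
    set c := TopologicalSpace.denseSeq A m
    obtain ⟨N, hN⟩ := hpow (ε / 3) (by positivity)
    let n := max N (max (k + 1) (m + 1))
    have hosc : ∀ l ≥ n, ∀ t ∈ Set.Icc (l : ℝ) (l + 1),
        ‖cocycleTwist β φ v (u t) (γ k) c - cocycleTwist β φ v (u l) (γ k) c‖ ≤ (1 / 2) ^ l := by
      intro l hl t ht
      refine huF l t ht _ (hKmem k l ?_) _ (hFmono ?_ (haF m)) <;> omega
    refine ⟨n, fun t ht => ?_⟩
    have e1 : ∀ t, ‖cocycleTwist β φ v (u t) (γ k) a - cocycleTwist β φ v (u t) (γ k) c‖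
        < ε / 3 := fun t => by
      rwa [← cocycleTwist_sub, norm_cocycleTwist, NonUnitalStarAlgHom.norm_map φ hinj,
        ← dist_eq_norm]
    have e2 := norm_sub_le_of_forall_Icc hosc le_rfl ht
    have e3 := hN n (le_max_left _ _)
    have e4 := e1 t
    have e5 := e1 n
    rw [← dist_eq_norm] at e2 e4 e5
    rw [dist_comm] at e5
    have e6 := dist_triangle4 (cocycleTwist β φ v (u t) (γ k) a)
      (cocycleTwist β φ v (u t) (γ k) c) (cocycleTwist β φ v (u n) (γ k) c)
      (cocycleTwist β φ v (u n) (γ k) a)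
    linarith
  choose W hW using fun g a => cauchySeq_tendsto_of_complete (hcauchy g a)
  obtain ⟨Φ, V, hΦV, hnorm, hWV⟩ := exists_limit_cocyclePair hβ hφv hinj h1 hW
  have hiso : Isometry Φ := AddMonoidHomClass.isometry_of_norm Φ hnorm
  have hV1 : (V 1 : B) = 1 := by simp [hΦV.1]
  have hdense : DenseRange Φ := by
    refine Metric.denseRange_iff.2 fun b ε hε => ?_
    obtain ⟨m, hm⟩ :=
      (TopologicalSpace.denseRange_denseSeq B).exists_dist_lt b (show 0 < ε / 3 by positivity)
    obtain ⟨N, hN⟩ := hpow (ε / 3) (by positivity)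
    let n := max N m
    obtain ⟨c, hc, hcb⟩ := hub n m (le_max_right _ _)
    set b' := TopologicalSpace.denseSeq B m
    have hosc : ∀ l ≥ n + 1, ∀ t ∈ Set.Icc (l : ℝ) (l + 1),
        ‖cocycleTwist β φ v (u t) 1 c - cocycleTwist β φ v (u l) 1 c‖ ≤ (1 / 2) ^ l :=
      fun l hl t ht => huF l t ht _ (Finset.mem_insert_self _ _) _ (hFmono hl hc)
    have e1 : ‖W 1 c - cocycleTwist β φ v (u (n + 1 : ℕ)) 1 c‖ ≤ 2 * (1 / 2) ^ (n + 1) := by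
      refine le_of_tendsto ((hW 1 c).sub_const _).norm ?_
      filter_upwards [eventually_ge_atTop ((n + 1 : ℕ) : ℝ)] with t ht
      exact norm_sub_le_of_forall_Icc hosc le_rfl ht
    have e2 : ‖b' - cocycleTwist β φ v (u (n + 1 : ℕ)) 1 c‖ ≤ 2 * (1 / 2) ^ n := by
      rw [← norm_star_unitary_conj (β 1) (u (n + 1 : ℕ))]
      have e : star (u (n + 1 : ℕ) : B) * (u (n + 1 : ℕ) : B) = 1 := (u (n + 1 : ℕ)).2.1
      have : star (u (n + 1 : ℕ) : B) * cocycleTwist β φ v (u (n + 1 : ℕ)) 1 c *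
          (u (n + 1 : ℕ) : B) = φ c := by
        calc _ = (star (u (n + 1 : ℕ) : B) * (u (n + 1 : ℕ) : B)) * φ c *
              (star (u (n + 1 : ℕ) : B) * (u (n + 1 : ℕ) : B)) := by
              simp only [cocycleTwist, hβ.1, hφv.1, OneMemClass.coe_one, mul_one, mul_assoc]
          _ = φ c := by rw [e, one_mul, mul_one]
      rwa [mul_sub, sub_mul, hβ.1, this]
    have e3 := hN n (le_max_left _ _)
    have e4 := hN (n + 1) ((le_max_left _ _).trans n.le_succ)
    rw [← dist_eq_norm] at e1 e2
    rw [dist_comm] at e1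
    have e5 := dist_triangle4 b b' (cocycleTwist β φ v (u (n + 1 : ℕ)) 1 c) (W 1 c)
    refine ⟨c, ?_⟩
    rw [hWV, hV1, one_mul] at e1 e5
    linarith
  have hsurj : Function.Surjective Φ := by
    rw [← Set.range_eq_univ, ← hiso.isClosedEmbedding.isClosed_range.closure_eq]
    exact hdense.closure_range
  refine ⟨StarAlgEquiv.ofBijective Φ ⟨hiso.injective, hsurj⟩, V, hΦV, u, hu, fun g a => ?_⟩
  have := ((hW g a).sub_const (W g a)).norm
  rw [sub_self, norm_zero, hWV] at this
  exact this
end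

section
/- Let A be a separable C*-algebra, B a separable unital C*-algebra, and φ: A → B_∞ a *-homomorphism into the sequence algebra of B such that for every map η: ℕ → ℕ with η(n) → ∞, the *-homomorphisms φ and η* ∘ φ are approximately unitarily equivalent. Let f_n: A → B (n ∈ ℕ) be functions such that for each a ∈ A the sequence (f_n(a))_n is bounded and its class in B_∞ equals φ(a). Then for every finite set F ⊆ A, every ε > 0, and every m ∈ ℕ, there exists an integer k ≥ m such that for every integer n ≥ k there is a unitary u ∈ U(B) with ‖u f_n(a) u* − f_k(a)‖ < ε for all a ∈ F. -/
open Filter Topology BoundedContinuousFunction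

/-- Approximate unitary equivalence of maps into a unital C⋆-algebra `Q`. -/
def ApproxUnitaryEquivUnital {A Q : Type*} [NonUnitalCStarAlgebra A] [CStarAlgebra Q]
    (φ ψ : A → Q) : Prop :=
  ∃ u : ℕ → unitary Q, ∀ a : A,
    Tendsto (fun k => ‖(u k : Q) * φ a * star (u k : Q) - ψ a‖) atTop (𝓝 (0 : ℝ))

/-- A function which inverts the square root near `1` stays close to `1`. -/
lemma abs_inv_sqrt_sub_one_le {t : ℝ} (ht : 1 / 2 ≤ t) :
    |(√t)⁻¹ - 1| ≤ 2 * |t - 1| := by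
  have h0 : 0 ≤ t := by linarith
  have hs : 1 / 2 ≤ √t := Real.le_sqrt_of_sq_le (by norm_num; linarith)
  have hsq : √t * √t = t := Real.mul_self_sqrt h0
  have hpos : 0 < √t := by linarith
  have e : (√t)⁻¹ - 1 = (1 - t) * ((√t)⁻¹ * (1 + √t)⁻¹) := by
    have h1 : (1 : ℝ) + √t ≠ 0 := by positivity
    field_simp
    nlinarith
  have h2 : (√t)⁻¹ ≤ 2 := by
    rw [inv_le_comm₀ hpos (by norm_num)]
    linarith
  have h3 : (1 + √t)⁻¹ ≤ 1 := inv_le_one_of_one_le₀ (by linarith)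
  have h4 : (√t)⁻¹ * (1 + √t)⁻¹ ≤ 2 * 1 := by gcongr
  rw [e, abs_mul, abs_sub_comm 1 t, abs_of_nonneg (by positivity : 0 ≤ (√t)⁻¹ * (1 + √t)⁻¹)]
  nlinarith [abs_nonneg (t - 1)]

/-- An almost unitary element of a C⋆-algebra is close to a unitary. -/
lemma exists_unitary_norm_sub_le {B : Type*} [CStarAlgebra B] (g : B)
    (h₁ : ‖star g * g - 1‖ ≤ 1 / 2) (h₂ : ‖g * star g - 1‖ ≤ 1 / 2) :
    ∃ u : unitary B, ‖(u : B) - g‖ ≤ ‖g‖ * (2 * ‖star g * g - 1‖) := by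
  have unit_of_near {x : B} (hx : ‖x - 1‖ ≤ 1 / 2) : IsUnit x := by
    have := isUnit_one_sub_of_norm_lt_one (x := 1 - x)
      (by rw [norm_sub_rev]; linarith)
    simpa using this
  have hsa : IsSelfAdjoint (star g * g) := IsSelfAdjoint.star_mul_self g
  have hdist : ∀ t ∈ spectrum ℝ (star g * g), |t - 1| ≤ ‖star g * g - 1‖ := by
    intro t ht
    have hc : star g * g - 1 = cfc (fun t : ℝ => t - 1) (star g * g) := by
      rw [cfc_sub .., cfc_id' .., cfc_const_one ..]
    rw [hc]
    exact norm_apply_le_norm_cfc (fun t : ℝ => t - 1) (star g * g) ht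
  have hhalf : ∀ t ∈ spectrum ℝ (star g * g), 1 / 2 ≤ t := fun t ht => by
    have := abs_le.1 ((hdist t ht).trans h₁)
    linarith [this.1]
  have hcont : ContinuousOn (fun t : ℝ => (√t)⁻¹) (spectrum ℝ (star g * g)) := by
    refine ContinuousOn.inv₀ (by fun_prop) fun t ht => ?_
    have := hhalf t ht
    exact (Real.sqrt_pos.2 (by linarith)).ne'
  set s : B := cfc (fun t : ℝ => (√t)⁻¹) (star g * g)
  have hs_sa : star s = s := (cfc_predicate (fun t : ℝ => (√t)⁻¹) (star g * g) :
    IsSelfAdjoint s)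
  have hshs : s * (star g * g) * s = 1 := by
    have hmul : cfc (fun t : ℝ => (√t)⁻¹ * t * (√t)⁻¹) (star g * g)
        = s * cfc (fun t : ℝ => t) (star g * g) * s := by
      rw [cfc_mul (fun t : ℝ => (√t)⁻¹ * t) (fun t : ℝ => (√t)⁻¹) (star g * g)
          (hcont.mul continuousOn_id) hcont,
        cfc_mul (fun t : ℝ => (√t)⁻¹) (fun t : ℝ => t) (star g * g) hcont continuousOn_id]
    rw [cfc_id' ℝ (star g * g) hsa] at hmul
    rw [← hmul, ← cfc_const_one ℝ (star g * g) hsa]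
    refine cfc_congr fun t ht => ?_
    have h0 : 0 < t := by linarith [hhalf t ht]
    have hpos : 0 < √t := Real.sqrt_pos.2 h0
    have := Real.mul_self_sqrt h0.le
    field_simp
    nlinarith
  have hss : ‖s - 1‖ ≤ 2 * ‖star g * g - 1‖ := by
    have hc : s - 1 = cfc (fun t : ℝ => (√t)⁻¹ - 1) (star g * g) := by
      rw [cfc_sub (fun t : ℝ => (√t)⁻¹) (fun _ => 1) (star g * g) hcont continuousOn_const,
        cfc_const_one ℝ (star g * g) hsa]
    rw [hc]
    refine norm_cfc_le (by positivity) fun t ht => ?_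
    exact (abs_inv_sqrt_sub_one_le (hhalf t ht)).trans (by gcongr; exact hdist t ht)
  have hleft : star (g * s) * (g * s) = 1 := by
    rw [star_mul, hs_sa, ← hshs]; noncomm_ring
  have hg : IsUnit g := by
    obtain ⟨y, hy⟩ := (unit_of_near h₂).exists_right_inv
    obtain ⟨z, hz⟩ := (unit_of_near h₁).exists_left_inv
    exact isUnit_iff_exists_and_exists.2
      ⟨⟨star g * y, by rw [← mul_assoc, hy]⟩, ⟨z * star g, by rw [mul_assoc, hz]⟩⟩
  have hs_unit : IsUnit s := isUnit_iff_exists_and_exists.2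
    ⟨⟨star g * g * s, by rw [← mul_assoc, hshs]⟩, ⟨s * (star g * g), hshs⟩⟩
  have hright : (g * s) * star (g * s) = 1 := by
    obtain ⟨w, hw⟩ := (hg.mul hs_unit).exists_right_inv
    have : star (g * s) = w := left_inv_eq_right_inv hleft hw
    rw [this, hw]
  refine ⟨⟨g * s, Unitary.mem_iff.2 ⟨hleft, hright⟩⟩, ?_⟩
  calc ‖g * s - g‖ = ‖g * (s - 1)‖ := by rw [mul_sub, mul_one]
    _ ≤ ‖g‖ * ‖s - 1‖ := norm_mul_le _ _
    _ ≤ _ := by gcongr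

section SequenceAlgebra

variable {B Q : Type*} [CStarAlgebra B] [CStarAlgebra Q] (π : (ℕ →ᵇ B) →⋆ₐ[ℂ] Q)

/-- Two bounded sequences have the same class iff their difference is a null sequence. -/
lemma map_eq_map_iff_tendsto_norm_sub
    (hker : ∀ f : ℕ →ᵇ B, π f = 0 ↔ Tendsto (fun n => ‖f n‖) atTop (𝓝 (0 : ℝ)))
    (f g : ℕ →ᵇ B) :
    π f = π g ↔ Tendsto (fun n => ‖f n - g n‖) atTop (𝓝 (0 : ℝ)) := by
  rw [← sub_eq_zero, ← map_sub, hker]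
  rfl

/-- The endomorphism of the sequence algebra induced by a reparametrisation. -/
lemma exists_starAlgHom_compContinuous (hsurj : Function.Surjective π)
    (hker : ∀ f : ℕ →ᵇ B, π f = 0 ↔ Tendsto (fun n => ‖f n‖) atTop (𝓝 (0 : ℝ)))
    (η : ℕ → ℕ) (hη : Tendsto η atTop atTop) :
    ∃ σ : Q →⋆ₐ[ℂ] Q, ∀ f : ℕ →ᵇ B,
      σ (π f) = π (f.compContinuous ⟨η, continuous_of_discreteTopology⟩) := by
  let c : (ℕ →ᵇ B) → (ℕ →ᵇ B) := fun f => f.compContinuous ⟨η, continuous_of_discreteTopology⟩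
  let τ : Q → Q := fun q => π (c (Function.surjInv hsurj q))
  have hτ (f : ℕ →ᵇ B) : τ (π f) = π (c f) := by
    rw [map_eq_map_iff_tendsto_norm_sub π hker]
    exact ((map_eq_map_iff_tendsto_norm_sub π hker _ _).1
      (Function.surjInv_eq hsurj (π f))).comp hη
  refine ⟨{ toFun := τ, map_one' := ?_, map_mul' := ?_, map_zero' := ?_, map_add' := ?_,
            commutes' := ?_, map_star' := ?_ }, hτ⟩
  · rw [← map_one π, hτ]; rfl
  · intro x y
    obtain ⟨x, rfl⟩ := hsurj x
    obtain ⟨y, rfl⟩ := hsurj y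
    rw [← map_mul, hτ, hτ, hτ, ← map_mul]; rfl
  · rw [← map_zero π, hτ]; rfl
  · intro x y
    obtain ⟨x, rfl⟩ := hsurj x
    obtain ⟨y, rfl⟩ := hsurj y
    rw [← map_add, hτ, hτ, hτ, ← map_add]; rfl
  · intro r
    rw [← AlgHomClass.commutes π r, hτ]; rfl
  · intro x
    obtain ⟨x, rfl⟩ := hsurj x
    rw [← map_star, hτ, hτ, ← map_star]; rfl

/-- The norm of a class in the sequence algebra eventually controls the norms of the terms, up to a
constant. -/
lemma exists_eventually_norm_lt (hsurj : Function.Surjective π)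
    (hker : ∀ f : ℕ →ᵇ B, π f = 0 ↔ Tendsto (fun n => ‖f n‖) atTop (𝓝 (0 : ℝ))) :
    ∃ C > 0, ∀ (g : ℕ →ᵇ B) (δ : ℝ), C * ‖π g‖ < δ → ∀ᶠ n in atTop, ‖g n‖ < δ := by
  let _ : CStarAlgebra (ℕ →ᵇ B) := { }
  let L : (ℕ →ᵇ B) →L[ℂ] Q :=
    ⟨(π : (ℕ →ᵇ B) →ₐ[ℂ] Q).toLinearMap, AddMonoidHomClass.continuous_of_bound π 1 fun x => by
      simpa using NonUnitalStarAlgHom.norm_apply_le π x⟩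
  obtain ⟨C, hC, h⟩ := L.exists_preimage_norm_le hsurj
  refine ⟨C, hC, fun g δ hδ => ?_⟩
  obtain ⟨g', hg', hn⟩ := h (π g)
  have ht := (map_eq_map_iff_tendsto_norm_sub π hker g g').1 hg'.symm
  filter_upwards [ht.eventually_lt_const (sub_pos.2 hδ)] with n hn'
  have h1 := g'.norm_coe_le_norm n
  have h2 := norm_add_le (g n - g' n) (g' n)
  rw [sub_add_cancel] at h2
  linarith

/-- Unitaries of the sequence algebra lift to sequences of unitaries. -/
lemma exists_unitary_lift (hsurj : Function.Surjective π)
    (hker : ∀ f : ℕ →ᵇ B, π f = 0 ↔ Tendsto (fun n => ‖f n‖) atTop (𝓝 (0 : ℝ)))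
    (v : unitary Q) :
    ∃ (u : ℕ → unitary B) (U : ℕ →ᵇ B), (∀ n, U n = u n) ∧ π U = v := by
  obtain ⟨g, hg⟩ := hsurj v
  have h₁ : Tendsto (fun n => ‖star (g n) * g n - 1‖) atTop (𝓝 0) :=
    (map_eq_map_iff_tendsto_norm_sub π hker (star g * g) 1).1
      (by rw [map_mul, map_star, hg, map_one, Unitary.star_mul_self_of_mem v.2])
  have h₂ : Tendsto (fun n => ‖g n * star (g n) - 1‖) atTop (𝓝 0) :=
    (map_eq_map_iff_tendsto_norm_sub π hker (g * star g) 1).1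
      (by rw [map_mul, map_star, hg, map_one, Unitary.mul_star_self_of_mem v.2])
  have hex (n : ℕ) : ∃ u : unitary B,
      ‖star (g n) * g n - 1‖ ≤ 1 / 2 → ‖g n * star (g n) - 1‖ ≤ 1 / 2 →
        ‖(u : B) - g n‖ ≤ ‖g n‖ * (2 * ‖star (g n) * g n - 1‖) := by
    by_cases h : ‖star (g n) * g n - 1‖ ≤ 1 / 2 ∧ ‖g n * star (g n) - 1‖ ≤ 1 / 2
    · obtain ⟨u, hu⟩ := exists_unitary_norm_sub_le (g n) h.1 h.2
      exact ⟨u, fun _ _ => hu⟩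
    · exact ⟨1, fun a b => (h ⟨a, b⟩).elim⟩
  choose u hu using hex
  have hbound (n : ℕ) : ‖(u n : B)‖ ≤ 1 + ‖(1 : B)‖ := by
    have : ‖(u n : B)‖ * ‖(u n : B)‖ = ‖(1 : B)‖ := by
      rw [← CStarRing.norm_star_mul_self, Unitary.coe_star_mul_self]
    nlinarith [sq_nonneg (‖(u n : B)‖ - 1)]
  let U : ℕ →ᵇ B := ofNormedAddCommGroup (fun n => (u n : B)) continuous_of_discreteTopology
    (1 + ‖(1 : B)‖) hbound
  refine ⟨u, U, fun n => rfl, ?_⟩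
  rw [← hg, map_eq_map_iff_tendsto_norm_sub π hker]
  have hlim : Tendsto (fun n => ‖g‖ * (2 * ‖star (g n) * g n - 1‖)) atTop (𝓝 0) := by
    simpa using (h₁.const_mul 2).const_mul ‖g‖
  refine squeeze_zero' (.of_forall fun n => norm_nonneg _) ?_ hlim
  filter_upwards [h₁.eventually_le_const (u := 1 / 2) (by norm_num),
    h₂.eventually_le_const (u := 1 / 2) (by norm_num)] with n hn₁ hn₂
  refine (hu n hn₁ hn₂).trans ?_
  gcongr
  exact g.norm_coe_le_norm n

end SequenceAlgebra

/-- Let `Q = B_∞` be the sequence algebra of a separable unital C⋆-algebra `B`,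
presented as a quotient of `ℓ∞(ℕ, B) = ℕ →ᵇ B` via a surjective ⋆-homomorphism `π` whose kernel
consists of the null sequences.  Suppose `φ : A → B_∞` is approximately unitarily equivalent
to `η⋆ ∘ φ` for every reparametrisation `η`, and `f n : A → B` are pointwise lifts of `φ`.
Then for each finite `F ⊆ A`, `ε > 0` and `m`, there is `k ≥ m` such that for every `n ≥ k`
some unitary `u ∈ U(B)` conjugates `f n` to within `ε` of `f k` on `F`. -/
theorem stmt9 {A B Q : Type*}
    [NonUnitalCStarAlgebra A] [TopologicalSpace.SeparableSpace A]
    [CStarAlgebra B] [TopologicalSpace.SeparableSpace B] [CStarAlgebra Q]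
    (π : (ℕ →ᵇ B) →⋆ₐ[ℂ] Q) (hsurj : Function.Surjective π)
    (hker : ∀ f : ℕ →ᵇ B, π f = 0 ↔ Tendsto (fun n => ‖f n‖) atTop (𝓝 (0 : ℝ)))
    (φ : A →⋆ₙₐ[ℂ] Q)
    (hrep : ∀ η : ℕ → ℕ, Tendsto η atTop atTop →
      ∀ σ : Q →⋆ₐ[ℂ] Q,
        (∀ f : ℕ →ᵇ B,
          σ (π f) = π (f.compContinuous ⟨η, continuous_of_discreteTopology⟩)) →
        ApproxUnitaryEquivUnital (⇑φ) (fun a => σ (φ a)))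
    (f : ℕ → A → B)
    (hf : ∀ a : A, ∃ F : ℕ →ᵇ B, (∀ n, F n = f n a) ∧ π F = φ a) :
    ∀ (F : Finset A) (ε : ℝ), 0 < ε → ∀ m : ℕ, ∃ k ≥ m, ∀ n ≥ k,
      ∃ u : unitary B, ∀ a ∈ F, ‖(u : B) * f n a * star (u : B) - f k a‖ < ε := by
  intro F ε hε m
  by_contra! hcon
  have hex (k : ℕ) : ∃ n ≥ k, m ≤ k → ∀ u : unitary B, ∃ a ∈ F,
      ε ≤ ‖(u : B) * f n a * star (u : B) - f k a‖ := by
    by_cases hk : m ≤ k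
    · obtain ⟨n, hn, h⟩ := hcon k hk
      exact ⟨n, hn, fun _ => h⟩
    · exact ⟨k, le_rfl, fun h => (hk h).elim⟩
  choose η hη_le hη using hex
  have hη_top : Tendsto η atTop atTop := tendsto_atTop_mono hη_le tendsto_id
  obtain ⟨σ, hσ⟩ := exists_starAlgHom_compContinuous π hsurj hker η hη_top
  obtain ⟨v, hv⟩ := hrep η hη_top σ hσ
  obtain ⟨C, hC, hCnorm⟩ := exists_eventually_norm_lt π hsurj hker
  have hsmall : ∀ᶠ j in atTop, ∀ a ∈ F,
      ‖(v j : Q) * φ a * star (v j : Q) - σ (φ a)‖ < ε / C :=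
    F.eventually_all.2 fun a _ => (hv a).eventually_lt_const (by positivity)
  obtain ⟨j, hj⟩ := hsmall.exists
  obtain ⟨u, U, hU, hUv⟩ := exists_unitary_lift π hsurj hker (v j)
  have hev : ∀ᶠ k in atTop, ∀ a ∈ F,
      ‖(u k : B) * f k a * star (u k : B) - f (η k) a‖ < ε := by
    refine F.eventually_all.2 fun a ha => ?_
    obtain ⟨G, hG, hGφ⟩ := hf a
    have := hCnorm (U * G * star U - G.compContinuous ⟨η, continuous_of_discreteTopology⟩) ε (by
      rw [map_sub, map_mul, map_mul, map_star, ← hσ, hUv, hGφ, mul_comm]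
      exact (lt_div_iff₀ hC).1 (hj a ha))
    filter_upwards [this] with k hk
    simpa [hU, hG] using hk
  obtain ⟨k, hk, hmk⟩ := (hev.and (eventually_ge_atTop m)).exists
  obtain ⟨a, ha, hle⟩ := hη k hmk (star (u k))
  refine (hk a ha).not_ge (hle.trans_eq ?_)
  have : (u k : B) * f k a * star (u k : B) - f (η k) a
      = (u k : B) * (f k a - star (u k : B) * f (η k) a * (u k : B)) * star (u k : B) := by
    have h := Unitary.mul_star_self_of_mem (u k).2
    calc _ = (u k : B) * f k a * star (u k : B)
          - ((u k : B) * star (u k : B)) * f (η k) a * ((u k : B) * star (u k : B)) := by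
            rw [h, one_mul, mul_one]
      _ = _ := by noncomm_ring
  have hu : star (u k : B) ∈ unitary B := Unitary.star_mem (u k).2
  rw [this, CStarRing.norm_mul_mem_unitary _ hu, CStarRing.norm_coe_unitary_mul, norm_sub_rev,
    Unitary.coe_star, star_star]
end
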